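/- Let X be a finite alphabet, Ψ = {S_j : X* → ℝ^p | j ∈ J} a family of formal power series, and let R be a rational representation of Ψ of dimension n. Then the following are equivalent: (i) R is a minimal representation of Ψ (every representation of Ψ has dimension ≥ n); (ii) R is reachable and observable; (iii) n equals the dimension of the linear span of the columns of the Hankel matrix H_Ψ. -/

import Mathlib

open Matrix

section PowerSeriesDefs

variable {X J : Type*} {p n : ℕ}

/-- `A_w = A_{σ_k} ⋯ A_{σ_1}` for the word `w = σ_1 ⋯ σ_k`. -/
def wordProd {n : ℕ} (A : X → Matrix (Fin n) (Fin n) ℝ) : List X → Matrix (Fin n) (Fin n) ℝ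
  | [] => 1
  | σ :: w => wordProd A w * A σ

/-- Column of the full Hankel matrix of the family `S`, indexed by `(w, j)`. -/
def hankelCol (S : J → List X → Fin p → ℝ) (w : List X) (j : J) : List X × Fin p → ℝ :=
  fun vi => S j (w ++ vi.1) vi.2

/-- Linear span of the columns of the full Hankel matrix `H_Ψ`. -/
def fullHankelSpan (S : J → List X → Fin p → ℝ) : Submodule ℝ (List X × Fin p → ℝ) :=
  Submodule.span ℝ (Set.range fun wj : List X × J => hankelCol S wj.1 wj.2)

/-- Column of the sub-Hankel matrix `H_{Ψ,M,K}` (rows restricted to `|v| ≤ M`). -/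
def hankelColTrunc (S : J → List X → Fin p → ℝ) (M : ℕ) (w : List X) (j : J) :
    {v : List X // v.length ≤ M} × Fin p → ℝ :=
  fun vi => S j (w ++ vi.1.1) vi.2

/-- `rank H_{Ψ,M,K}` : dimension of the span of the columns of the sub-Hankel matrix
whose rows are indexed by `(v,i)` with `|v| ≤ M` and whose columns are indexed by
`(w,j)` with `|w| ≤ K`. -/
noncomputable def hankelRank (S : J → List X → Fin p → ℝ) (M K : ℕ) : ℕ :=
  Module.finrank ℝ (Submodule.span ℝ
    (Set.range fun wj : {w : List X // w.length ≤ K} × J =>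
      hankelColTrunc S M wj.1.1 wj.2))

/-- `R = (ℝⁿ, {A_σ}, B, C)` is an `N`-partial representation of the family `S`. -/
def IsPartialRep (S : J → List X → Fin p → ℝ) (N : ℕ)
    (A : X → Matrix (Fin n) (Fin n) ℝ) (B : J → Fin n → ℝ)
    (C : Matrix (Fin p) (Fin n) ℝ) : Prop :=
  ∀ (j : J) (w : List X), w.length ≤ N → S j w = C.mulVec ((wordProd A w).mulVec (B j))

/-- `R = (ℝⁿ, {A_σ}, B, C)` is a (complete) representation of the family `S`. -/
def IsRep (S : J → List X → Fin p → ℝ)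
    (A : X → Matrix (Fin n) (Fin n) ℝ) (B : J → Fin n → ℝ)
    (C : Matrix (Fin p) (Fin n) ℝ) : Prop :=
  ∀ (j : J) (w : List X), S j w = C.mulVec ((wordProd A w).mulVec (B j))

/-- Reachability: the span of the vectors `A_w B_j` is the whole state space. -/
def IsReachable (A : X → Matrix (Fin n) (Fin n) ℝ) (B : J → Fin n → ℝ) : Prop :=
  Submodule.span ℝ
    {x : Fin n → ℝ | ∃ (w : List X) (j : J), x = (wordProd A w).mulVec (B j)} = ⊤

/-- Observability: the intersection of the kernels of the maps `C A_w` is trivial. -/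
def IsObservable (A : X → Matrix (Fin n) (Fin n) ℝ)
    (C : Matrix (Fin p) (Fin n) ℝ) : Prop :=
  ∀ x : Fin n → ℝ, (∀ w : List X, C.mulVec ((wordProd A w).mulVec x) = 0) → x = 0

end PowerSeriesDefs

section Realization

variable {X J : Type*} {p n : ℕ}

lemma wordProd_append (A : X → Matrix (Fin n) (Fin n) ℝ) (w v : List X) :
    wordProd A (w ++ v) = wordProd A v * wordProd A w := by
  induction w with
  | nil => simp [wordProd]
  | cons σ w ih => simp [wordProd, ih, Matrix.mul_assoc]

/-- The observability map `x ↦ ((v, i) ↦ (C A_v x)_i)`. -/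
def obsMap (A : X → Matrix (Fin n) (Fin n) ℝ) (C : Matrix (Fin p) (Fin n) ℝ) :
    (Fin n → ℝ) →ₗ[ℝ] (List X × Fin p → ℝ) where
  toFun x vi := C.mulVec ((wordProd A vi.1).mulVec x) vi.2
  map_add' x y := by ext; simp [Matrix.mulVec_add]
  map_smul' c x := by ext; simp [Matrix.mulVec_smul]

/-- The span of the reachable vectors `A_w B_j`. -/
def reachSpan (A : X → Matrix (Fin n) (Fin n) ℝ) (B : J → Fin n → ℝ) :
    Submodule ℝ (Fin n → ℝ) :=
  Submodule.span ℝ {x : Fin n → ℝ | ∃ (w : List X) (j : J), x = (wordProd A w).mulVec (B j)}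

lemma isObservable_iff_ker_obsMap (A : X → Matrix (Fin n) (Fin n) ℝ)
    (C : Matrix (Fin p) (Fin n) ℝ) : IsObservable A C ↔ LinearMap.ker (obsMap A C) = ⊥ := by
  rw [LinearMap.ker_eq_bot']
  refine forall_congr' fun x => imp_congr_left ⟨fun h => ?_, fun h w => ?_⟩
  · ext vi
    exact congrFun (h vi.1) vi.2
  · ext i
    exact congrFun h (w, i)

lemma IsRep.fullHankelSpan_eq {S : J → List X → Fin p → ℝ}
    {A : X → Matrix (Fin n) (Fin n) ℝ} {B : J → Fin n → ℝ} {C : Matrix (Fin p) (Fin n) ℝ}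
    (h : IsRep S A B C) : fullHankelSpan S = (reachSpan A B).map (obsMap A C) := by
  have hcol (w : List X) (j : J) :
      hankelCol S w j = obsMap A C ((wordProd A w).mulVec (B j)) := by
    ext vi
    simp [hankelCol, obsMap, h j, wordProd_append, Matrix.mul_assoc]
  rw [fullHankelSpan, reachSpan, Submodule.map_span]
  congr 1
  ext f
  constructor
  · rintro ⟨⟨w, j⟩, rfl⟩
    exact ⟨_, ⟨w, j, rfl⟩, (hcol w j).symm⟩
  · rintro ⟨_, ⟨w, j, rfl⟩, rfl⟩
    exact ⟨(w, j), hcol w j⟩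

lemma IsRep.finiteDimensional_fullHankelSpan {S : J → List X → Fin p → ℝ}
    {A : X → Matrix (Fin n) (Fin n) ℝ} {B : J → Fin n → ℝ} {C : Matrix (Fin p) (Fin n) ℝ}
    (h : IsRep S A B C) : FiniteDimensional ℝ (fullHankelSpan S) := by
  rw [h.fullHankelSpan_eq]
  infer_instance

lemma IsRep.finrank_fullHankelSpan_le {S : J → List X → Fin p → ℝ}
    {A : X → Matrix (Fin n) (Fin n) ℝ} {B : J → Fin n → ℝ} {C : Matrix (Fin p) (Fin n) ℝ}
    (h : IsRep S A B C) : Module.finrank ℝ (fullHankelSpan S) ≤ n := by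
  rw [h.fullHankelSpan_eq]
  exact (Submodule.finrank_map_le _ _).trans
    ((Submodule.finrank_le _).trans_eq (Module.finrank_fin_fun ℝ))

lemma IsRep.finrank_fullHankelSpan_eq_iff {S : J → List X → Fin p → ℝ}
    {A : X → Matrix (Fin n) (Fin n) ℝ} {B : J → Fin n → ℝ} {C : Matrix (Fin p) (Fin n) ℝ}
    (h : IsRep S A B C) :
    Module.finrank ℝ (fullHankelSpan S) = n ↔ IsReachable A B ∧ IsObservable A C := by
  rw [h.fullHankelSpan_eq, isObservable_iff_ker_obsMap]
  change _ ↔ reachSpan A B = ⊤ ∧ _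
  have hn : Module.finrank ℝ (Fin n → ℝ) = n := Module.finrank_fin_fun ℝ
  constructor
  · intro hr
    have htop : reachSpan A B = ⊤ := by
      refine Submodule.eq_top_of_finrank_eq (le_antisymm (Submodule.finrank_le _) ?_)
      rw [hn]
      exact hr.symm.trans_le (Submodule.finrank_map_le _ _)
    refine ⟨htop, ?_⟩
    rw [htop, Submodule.map_top] at hr
    have hsum := LinearMap.finrank_range_add_finrank_ker (obsMap A C)
    rw [← Submodule.finrank_eq_zero (R := ℝ)]
    omega
  · rintro ⟨htop, hker⟩
    rw [htop, Submodule.map_top,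
      LinearMap.finrank_range_of_inj (LinearMap.ker_eq_bot.mp hker), hn]

/-- The left shift by `σ`, sending `f` to `(v, i) ↦ f (σ v, i)`. -/
def letterShift (σ : X) : (List X × Fin p → ℝ) →ₗ[ℝ] (List X × Fin p → ℝ) :=
  LinearMap.funLeft ℝ ℝ fun vi => (σ :: vi.1, vi.2)

lemma letterShift_mem_fullHankelSpan (S : J → List X → Fin p → ℝ) (σ : X) :
    ∀ f ∈ fullHankelSpan S, letterShift σ f ∈ fullHankelSpan S := by
  change fullHankelSpan S ≤ (fullHankelSpan S).comap (letterShift σ)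
  refine Submodule.span_le.mpr ?_
  rintro _ ⟨⟨w, j⟩, rfl⟩
  refine Submodule.subset_span ⟨(w ++ [σ], j), ?_⟩
  ext vi
  simp [hankelCol, letterShift, LinearMap.funLeft_apply]

/-- A family whose Hankel matrix has finite rank `r` has a representation of dimension `r`,
with the span of the Hankel columns as its state space. -/
lemma exists_isRep_finrank_fullHankelSpan (S : J → List X → Fin p → ℝ)
    [FiniteDimensional ℝ (fullHankelSpan S)] :
    ∃ (A : X → Matrix (Fin (Module.finrank ℝ (fullHankelSpan S)))
        (Fin (Module.finrank ℝ (fullHankelSpan S))) ℝ)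
      (B : J → Fin (Module.finrank ℝ (fullHankelSpan S)) → ℝ)
      (C : Matrix (Fin p) (Fin (Module.finrank ℝ (fullHankelSpan S))) ℝ), IsRep S A B C := by
  let e := (Module.finBasis ℝ (fullHankelSpan S)).equivFun
  let T (σ : X) := (letterShift σ).restrict (letterShift_mem_fullHankelSpan S σ)
  let c : fullHankelSpan S →ₗ[ℝ] (Fin p → ℝ) :=
    (LinearMap.funLeft ℝ ℝ fun i => (([] : List X), i)) ∘ₗ (fullHankelSpan S).subtype
  let A (σ : X) := LinearMap.toMatrix' (e.toLinearMap ∘ₗ T σ ∘ₗ e.symm.toLinearMap)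
  let C := LinearMap.toMatrix' (c ∘ₗ e.symm.toLinearMap)
  have key (w : List X) : ∀ (f : fullHankelSpan S) (i : Fin p),
      C.mulVec ((wordProd A w).mulVec (e f)) i = f.1 (w, i) := by
    induction w with
    | nil =>
      intro f i
      simp [wordProd, C, c, LinearMap.toMatrix'_mulVec, LinearMap.funLeft_apply]
    | cons σ w ih =>
      intro f i
      have hA : (A σ).mulVec (e f) = e (T σ f) := by
        simp [A, LinearMap.toMatrix'_mulVec]
      rw [wordProd, ← Matrix.mulVec_mulVec, hA, ih]
      rfl
  refine ⟨A, fun j => e ⟨hankelCol S [] j, Submodule.subset_span ⟨([], j), rfl⟩⟩, C, ?_⟩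
  intro j w
  ext i
  exact (key w ⟨hankelCol S [] j, _⟩ i).symm

end Realization

/-- for a rational representation `R` of `Ψ` of dimension `n`, the
following are equivalent: (i) `R` is minimal; (ii) `R` is reachable and observable;
(iii) `n` equals the dimension of the span of the columns of the Hankel matrix `H_Ψ`. -/
theorem stmt10 {X J : Type*} [Fintype X] {p n : ℕ} (S : J → List X → Fin p → ℝ)
    (A : X → Matrix (Fin n) (Fin n) ℝ) (B : J → Fin n → ℝ)
    (C : Matrix (Fin p) (Fin n) ℝ) (hrep : IsRep S A B C) :
    ((∀ (n' : ℕ) (A' : X → Matrix (Fin n') (Fin n') ℝ) (B' : J → Fin n' → ℝ)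
        (C' : Matrix (Fin p) (Fin n') ℝ), IsRep S A' B' C' → n ≤ n') ↔
      (IsReachable A B ∧ IsObservable A C)) ∧
    ((∀ (n' : ℕ) (A' : X → Matrix (Fin n') (Fin n') ℝ) (B' : J → Fin n' → ℝ)
        (C' : Matrix (Fin p) (Fin n') ℝ), IsRep S A' B' C' → n ≤ n') ↔
      Module.rank ℝ (fullHankelSpan S) = (n : Cardinal)) := by
  have := hrep.finiteDimensional_fullHankelSpan
  have hmin : (∀ (n' : ℕ) (A' : X → Matrix (Fin n') (Fin n') ℝ) (B' : J → Fin n' → ℝ)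
      (C' : Matrix (Fin p) (Fin n') ℝ), IsRep S A' B' C' → n ≤ n') ↔
      Module.finrank ℝ (fullHankelSpan S) = n := by
    constructor
    · intro h
      obtain ⟨A', B', C', h'⟩ := exists_isRep_finrank_fullHankelSpan S
      exact le_antisymm hrep.finrank_fullHankelSpan_le (h _ A' B' C' h')
    · intro h n' A' B' C' h'
      exact h.symm.trans_le h'.finrank_fullHankelSpan_le
  refine ⟨hmin.trans hrep.finrank_fullHankelSpan_eq_iff, hmin.trans ?_⟩
  rw [← Module.finrank_eq_rank, Nat.cast_inj]
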